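/- arXiv:1011.0966 — 3 statements merged into one kernel-verified Lean document; each statement's English description precedes it below -/
import Mathlib

section
/- Let r, s, t ≥ 0 satisfy min(r,s) > t and r + s > 1/2 + t. Then there exists a constant C > 0 such that for all sequences a, b : ℤ → ℂ with ‖a‖_r < ∞ and ‖b‖_s < ∞, the convolution c_k = Σ_{ℓ∈ℤ} a_ℓ b_{k−ℓ} converges absolutely for every k ∈ ℤ and satisfies ‖c‖_t ≤ C ‖a‖_r ‖b‖_s. (This is the Sobolev product estimate ‖fg‖_t ≲ ‖f‖_r ‖g‖_s for 2π-periodic functions, written in terms of Fourier coefficients.) -/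
open scoped BigOperators

/-- The squared Sobolev norm `‖a‖_σ² = Σ_{k∈ℤ} (1+k²)^σ |a_k|²` of a sequence of
Fourier coefficients. -/
noncomputable def sobNormSq (σ : ℝ) (a : ℤ → ℂ) : ℝ :=
  ∑' k : ℤ, (1 + (k : ℝ) ^ 2) ^ σ * ‖a k‖ ^ 2

/-- Cauchy–Schwarz for series, in a form that also yields summability. -/
theorem summable_and_sq_tsum_le_of_sq_le_mul {ι : Type*} {x u v : ι → ℝ}
    (hx : ∀ i, 0 ≤ x i) (hu : ∀ i, 0 ≤ u i) (hv : ∀ i, 0 ≤ v i)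
    (hxuv : ∀ i, x i ^ 2 ≤ u i * v i) (hus : Summable u) (hvs : Summable v) :
    Summable x ∧ (∑' i, x i) ^ 2 ≤ (∑' i, u i) * ∑' i, v i := by
  have hU : 0 ≤ ∑' i, u i := tsum_nonneg hu
  have hV : 0 ≤ ∑' i, v i := tsum_nonneg hv
  have key : ∀ F : Finset ι, ∑ i ∈ F, x i ≤ √((∑' i, u i) * ∑' i, v i) := fun F ↦ by
    calc ∑ i ∈ F, x i ≤ ∑ i ∈ F, √(u i) * √(v i) :=
          Finset.sum_le_sum fun i _ ↦ by
            rw [← Real.sqrt_mul (hu i)]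
            exact Real.le_sqrt_of_sq_le (hxuv i)
      _ ≤ √(∑ i ∈ F, u i) * √(∑ i ∈ F, v i) :=
          Real.sum_sqrt_mul_sqrt_le F hu hv
      _ ≤ √(∑' i, u i) * √(∑' i, v i) := by
          gcongr
          · exact hus.sum_le_tsum F fun i _ ↦ hu i
          · exact hvs.sum_le_tsum F fun i _ ↦ hv i
      _ = _ := (Real.sqrt_mul hU _).symm
  refine ⟨summable_of_sum_le hx key, ?_⟩
  calc (∑' i, x i) ^ 2 ≤ √((∑' i, u i) * ∑' i, v i) ^ 2 := by
        gcongr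
        · exact tsum_nonneg hx
        · exact Real.tsum_le_of_sum_le hx key
    _ = _ := Real.sq_sqrt (mul_nonneg hU hV)

theorem summable_one_add_int_sq_rpow_neg {p : ℝ} (hp : 1 / 2 < p) :
    Summable fun k : ℤ ↦ (1 + (k : ℝ) ^ 2) ^ (-p) := by
  refine (Real.summable_abs_int_rpow (b := 2 * p) (by linarith)).of_norm_bounded_eventually ?_
  filter_upwards [(Set.finite_singleton (0 : ℤ)).compl_mem_cofinite] with k hk
  have hk' : 0 < |(k : ℝ)| := by simpa using hk
  rw [Real.norm_of_nonneg (by positivity), neg_mul_eq_mul_neg, Real.rpow_mul hk'.le]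
  refine Real.rpow_le_rpow_of_nonpos (by positivity) ?_ (by linarith)
  simp

/-- If the weights satisfy `w ≤ 4 v` and `u ≤ v`, the product weight is controlled by `u`. -/
theorem rpow_le_mul_rpow_neg_mul {u v w r s t : ℝ} (hu : 0 < u) (hw : 0 < w) (huv : u ≤ v)
    (hwv : w ≤ 4 * v) (ht : 0 ≤ t) (hts : t ≤ s) :
    w ^ t ≤ 4 ^ t * u ^ (-(r + s - t)) * (u ^ r * v ^ s) := by
  have hv : 0 < v := hu.trans_le huv
  calc w ^ t ≤ (4 * v) ^ t := Real.rpow_le_rpow hw.le hwv ht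
    _ = 4 ^ t * v ^ t * (u ^ (t - s) * u ^ (s - t)) := by
        rw [Real.mul_rpow (by norm_num) hv.le, ← Real.rpow_add hu]; simp
    _ ≤ 4 ^ t * v ^ t * (u ^ (t - s) * v ^ (s - t)) := by
        gcongr
    _ = 4 ^ t * u ^ (t - s) * (v ^ t * v ^ (s - t)) := by ring
    _ = 4 ^ t * u ^ (-(r + s - t)) * (u ^ r * v ^ s) := by
        rw [← Real.rpow_add hv, add_sub_cancel, ← mul_assoc, mul_assoc _ _ (u ^ r),
          ← Real.rpow_add hu]
        congr 3
        ring

theorem rpow_le_mul_add_rpow_neg_mul {u v w r s t : ℝ} (hu : 0 < u) (hv : 0 < v) (hw : 0 < w)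
    (hwuv : w ≤ 4 * max u v) (ht : 0 ≤ t) (htr : t ≤ r) (hts : t ≤ s) :
    w ^ t ≤ 4 ^ t * (u ^ (-(r + s - t)) + v ^ (-(r + s - t))) * (u ^ r * v ^ s) := by
  have hu' : 0 ≤ 4 ^ t * u ^ (-(r + s - t)) * (u ^ r * v ^ s) := by positivity
  have hv' : 0 ≤ 4 ^ t * v ^ (-(r + s - t)) * (u ^ r * v ^ s) := by positivity
  rcases le_total u v with h | h
  · rw [max_eq_right h] at hwuv
    linarith [rpow_le_mul_rpow_neg_mul (r := r) hu hw h hwuv ht hts]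
  · rw [max_eq_left h] at hwuv
    have := rpow_le_mul_rpow_neg_mul (r := s) hv hw h hwuv ht htr
    rw [add_comm s r, mul_comm (v ^ s)] at this
    linarith

theorem one_add_sq_le_four_mul_max (k l : ℝ) :
    1 + k ^ 2 ≤ 4 * max (1 + l ^ 2) (1 + (k - l) ^ 2) := by
  have h₁ := le_max_left (1 + l ^ 2) (1 + (k - l) ^ 2)
  have h₂ := le_max_right (1 + l ^ 2) (1 + (k - l) ^ 2)
  nlinarith [sq_nonneg (2 * l - k)]

/-- The bijection `(k, l) ↦ (l, k - l)`. -/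
def convolutionEquiv : ℤ × ℤ ≃ ℤ × ℤ where
  toFun q := (q.2, q.1 - q.2)
  invFun q := (q.1 + q.2, q.1)
  left_inv q := by simp
  right_inv q := by simp

theorem hasSum_convolution {f g : ℤ → ℝ} (hf0 : 0 ≤ f) (hg0 : 0 ≤ g)
    (hf : Summable f) (hg : Summable g) :
    (∀ k, Summable fun l ↦ f l * g (k - l)) ∧
      HasSum (fun k ↦ ∑' l, f l * g (k - l)) ((∑' l, f l) * ∑' l, g l) := by
  have hfg : Summable fun q : ℤ × ℤ ↦ f q.1 * g q.2 := hf.mul_of_nonneg hg hf0 hg0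
  have hc : HasSum (fun q : ℤ × ℤ ↦ f q.2 * g (q.1 - q.2)) ((∑' l, f l) * ∑' l, g l) := by
    rw [hf.tsum_mul_tsum hg hfg]
    exact (convolutionEquiv.hasSum_iff (f := fun q : ℤ × ℤ ↦ f q.1 * g q.2)).2 hfg.hasSum
  have hk : ∀ k, Summable fun l ↦ f l * g (k - l) := hc.summable.prod_factor
  exact ⟨hk, hc.prod_fiberwise fun k ↦ (hk k).hasSum⟩

/-- Sobolev product estimate `‖fg‖_t ≲ ‖f‖_r ‖g‖_s` in terms of Fourier coefficients. -/
theorem stmt_0 (r s t : ℝ) (hr : 0 ≤ r) (hs : 0 ≤ s) (ht : 0 ≤ t)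
    (hmin : t < min r s) (hsum : 1 / 2 + t < r + s) :
    ∃ C > 0, ∀ a b : ℤ → ℂ,
      Summable (fun k : ℤ => (1 + (k : ℝ) ^ 2) ^ r * ‖a k‖ ^ 2) →
      Summable (fun k : ℤ => (1 + (k : ℝ) ^ 2) ^ s * ‖b k‖ ^ 2) →
      (∀ k : ℤ, Summable (fun ℓ : ℤ => ‖a ℓ * b (k - ℓ)‖)) ∧
      Summable (fun k : ℤ =>
        (1 + (k : ℝ) ^ 2) ^ t * ‖∑' ℓ : ℤ, a ℓ * b (k - ℓ)‖ ^ 2) ∧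
      Real.sqrt (sobNormSq t (fun k => ∑' ℓ : ℤ, a ℓ * b (k - ℓ))) ≤
        C * Real.sqrt (sobNormSq r a) * Real.sqrt (sobNormSq s b) := by
  obtain ⟨htr, hts⟩ := lt_min_iff.1 hmin
  set W : ℤ → ℝ := fun k ↦ 1 + (k : ℝ) ^ 2 with hW
  have hWpos : ∀ k, 0 < W k := fun k ↦ by positivity
  set α : ℤ → ℝ := fun k ↦ W k ^ (-(r + s - t)) with hα
  have hα0 : ∀ k, 0 < α k := fun k ↦ Real.rpow_pos_of_pos (hWpos k) _
  have hαs : Summable α := summable_one_add_int_sq_rpow_neg (by linarith)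
  set M : ℝ := 4 ^ t * ((∑' k, α k) + ∑' k, α k) with hM
  have hM0 : 0 < M := by
    have : 0 < ∑' k, α k := hαs.tsum_pos (fun k ↦ (hα0 k).le) 0 (hα0 0)
    positivity
  refine ⟨√M, Real.sqrt_pos.2 hM0, fun a b ha hb ↦ ?_⟩
  have hf0 : 0 ≤ fun k ↦ W k ^ r * ‖a k‖ ^ 2 := fun k ↦
    mul_nonneg (Real.rpow_nonneg (hWpos k).le _) (sq_nonneg _)
  have hg0 : 0 ≤ fun k ↦ W k ^ s * ‖b k‖ ^ 2 := fun k ↦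
    mul_nonneg (Real.rpow_nonneg (hWpos k).le _) (sq_nonneg _)
  obtain ⟨hF, hFsum⟩ := hasSum_convolution hf0 hg0 ha hb
  have hcs (k : ℤ) : Summable (fun l ↦ ‖a l * b (k - l)‖) ∧
      (∑' l, ‖a l * b (k - l)‖) ^ 2 ≤ (W k ^ t)⁻¹ * M *
        ∑' l, W l ^ r * ‖a l‖ ^ 2 * (W (k - l) ^ s * ‖b (k - l)‖ ^ 2) := by
    have hk : 0 < W k ^ t := Real.rpow_pos_of_pos (hWpos k) t
    have hα' : Summable fun l ↦ α (k - l) := (Equiv.subLeft k).summable_iff.2 hαs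
    have hM' : ∑' l, (W k ^ t)⁻¹ * (4 ^ t * (α l + α (k - l))) = (W k ^ t)⁻¹ * M := by
      rw [tsum_mul_left, tsum_mul_left, hαs.tsum_add hα',
        show ∑' l, α (k - l) = ∑' l, α l from (Equiv.subLeft k).tsum_eq α]
    rw [← hM']
    refine summable_and_sq_tsum_le_of_sq_le_mul (fun _ ↦ norm_nonneg _) (fun l ↦ ?_)
      (fun l ↦ mul_nonneg (hf0 l) (hg0 (k - l))) (fun l ↦ ?_)
      (((hαs.add hα').mul_left _).mul_left _) (hF k)
    · have := hα0 l
      have := hα0 (k - l)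
      positivity
    · have hw : W k ≤ 4 * max (W l) (W (k - l)) := by
        simpa [hW] using one_add_sq_le_four_mul_max (k : ℝ) l
      have := rpow_le_mul_add_rpow_neg_mul (hWpos l) (hWpos (k - l)) (hWpos k) hw ht htr.le hts.le
      rw [mul_assoc, ← div_eq_inv_mul, le_div_iff₀ hk, norm_mul]
      calc (‖a l‖ * ‖b (k - l)‖) ^ 2 * W k ^ t ≤ (‖a l‖ * ‖b (k - l)‖) ^ 2 *
              (4 ^ t * (α l + α (k - l)) * (W l ^ r * W (k - l) ^ s)) := by gcongr
        _ = _ := by ring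
  have hbound (k : ℤ) : W k ^ t * ‖∑' l, a l * b (k - l)‖ ^ 2 ≤
      M * ∑' l, W l ^ r * ‖a l‖ ^ 2 * (W (k - l) ^ s * ‖b (k - l)‖ ^ 2) := by
    have hk : 0 < W k ^ t := Real.rpow_pos_of_pos (hWpos k) t
    calc W k ^ t * ‖∑' l, a l * b (k - l)‖ ^ 2
        ≤ W k ^ t * (∑' l, ‖a l * b (k - l)‖) ^ 2 := by
          gcongr
          exact norm_tsum_le_tsum_norm (hcs k).1
      _ ≤ W k ^ t * ((W k ^ t)⁻¹ * M * _) := by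
          gcongr
          exact (hcs k).2
      _ = _ := by rw [mul_assoc _ M, mul_inv_cancel_left₀ hk.ne']
  have hcsum : Summable fun k ↦ W k ^ t * ‖∑' l, a l * b (k - l)‖ ^ 2 :=
    (hFsum.summable.mul_left M).of_nonneg_of_le
      (fun k ↦ mul_nonneg (Real.rpow_nonneg (hWpos k).le _) (sq_nonneg _)) hbound
  refine ⟨fun k ↦ (hcs k).1, hcsum, ?_⟩
  have ha0 : 0 ≤ sobNormSq r a := tsum_nonneg hf0
  rw [← Real.sqrt_mul hM0.le, ← Real.sqrt_mul (mul_nonneg hM0.le ha0), mul_assoc]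
  refine Real.sqrt_le_sqrt ((hcsum.tsum_le_tsum hbound (hFsum.summable.mul_left M)).trans_eq ?_)
  rw [tsum_mul_left, hFsum.tsum_eq]
  rfl
end

section
/- Let β ∈ [0,1). Then there exists C > 0 such that for all ε ∈ (0,1], all bounded continuous 2π-periodic u : ℝ → ℝⁿ with u ∈ H^β (componentwise), and all G ∈ C¹(ℝⁿ; ℝⁿ), one has ‖D_ε G(u) − ∂_x G(u)‖_{−1} ≤ C ε^β ‖G_u‖_{C¹} (1 + ‖u‖_β), where ‖G_u‖_{C¹} := sup{ |G(x)| + |∇G(x)| : |x| ≤ ‖u‖_{L^∞} } and ∂_x acts as the Fourier multiplier ik. -/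
open MeasureTheory Real
open scoped BigOperators

/-- The `k`-th Fourier coefficient of component `i` of a `2π`-periodic function
`w : ℝ → ℝⁿ`. -/
noncomputable def pcoef {n : ℕ} (w : ℝ → EuclideanSpace ℝ (Fin n)) (k : ℤ) (i : Fin n) : ℂ :=
  (1 / (2 * π) : ℝ) * ∫ x in (0 : ℝ)..(2 * π), Complex.exp (-Complex.I * k * x) * (w x i : ℂ)

/-- The squared Sobolev norm `‖w‖_σ² = Σ_{k∈ℤ} (1+k²)^σ Σᵢ |w_{k,i}|²` of a `2π`-periodic
vector-valued function. -/
noncomputable def fnSobSq {n : ℕ} (σ : ℝ) (w : ℝ → EuclideanSpace ℝ (Fin n)) : ℝ :=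
  ∑' k : ℤ, (1 + (k : ℝ) ^ 2) ^ σ * ∑ i, ‖pcoef w k i‖ ^ 2

/-- The approximate derivative `(D_ε v)(x) = ε^{-1} ∫ v(x+εy) μ(dy)`, for the signed
measure `μ = μp - μn`. -/
noncomputable def Deps {n : ℕ} (μp μn : Measure ℝ) (ε : ℝ)
    (v : ℝ → EuclideanSpace ℝ (Fin n)) (x : ℝ) : EuclideanSpace ℝ (Fin n) :=
  ε⁻¹ • ((∫ y, v (x + ε * y) ∂μp) - ∫ y, v (x + ε * y) ∂μn)

/-- `‖G_u‖_{C¹} = sup { |G(x)| + |∇G(x)| : |x| ≤ R }`. -/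
noncomputable def C1normOn {n : ℕ}
    (G : EuclideanSpace ℝ (Fin n) → EuclideanSpace ℝ (Fin n)) (R : ℝ) : ℝ :=
  ⨆ x ∈ {y : EuclideanSpace ℝ (Fin n) | ‖y‖ ≤ R}, (‖G x‖ + ‖fderiv ℝ G x‖)

theorem pcoef_eq_fourierCoeffOn {n : ℕ} (w : ℝ → EuclideanSpace ℝ (Fin n)) (k : ℤ) (i : Fin n) :
    pcoef w k i = fourierCoeffOn two_pi_pos (fun x => (w x i : ℂ)) k := by
  rw [fourierCoeffOn_eq_integral, pcoef, Complex.real_smul, sub_zero]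
  congr 1
  refine intervalIntegral.integral_congr fun x _ => ?_
  simp only [fourier_coe_apply, smul_eq_mul]
  congr 2
  push_cast
  field_simp

/-- Parseval's identity for continuous vector-valued functions. -/
theorem hasSum_sq_pcoef {n : ℕ} {w : ℝ → EuclideanSpace ℝ (Fin n)} (hw : Continuous w) :
    HasSum (fun k : ℤ => ∑ i, ‖pcoef w k i‖ ^ 2)
      ((2 * π)⁻¹ * ∫ x in (0 : ℝ)..(2 * π), ‖w x‖ ^ 2) := by
  have hwi (i : Fin n) : Continuous fun x => (w x i : ℂ) := by fun_prop
  have h (i : Fin n) : HasSum (fun k : ℤ => ‖pcoef w k i‖ ^ 2)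
      ((2 * π)⁻¹ * ∫ x in (0 : ℝ)..(2 * π), ‖w x i‖ ^ 2) := by
    have hL : MemLp (fun x => (w x i : ℂ)) 2 (volume.restrict (Set.Ioc 0 (2 * π))) :=
      (memLp_two_iff_integrable_sq_norm (hwi i).aestronglyMeasurable).2
        (((hwi i).norm.pow 2).integrableOn_Ioc)
    have := hasSum_sq_fourierCoeffOn two_pi_pos hL
    simpa only [pcoef_eq_fourierCoeffOn, sub_zero, smul_eq_mul, Complex.norm_real] using this
  convert hasSum_sum fun i _ => h i using 1
  rw [← Finset.mul_sum, ← intervalIntegral.integral_finsetSum]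
  · simp only [EuclideanSpace.norm_sq_eq]
  · intro i _
    exact Continuous.intervalIntegrable (by fun_prop) _ _

theorem pcoef_comp_add {n : ℕ} {w : ℝ → EuclideanSpace ℝ (Fin n)}
    (hp : Function.Periodic w (2 * π)) (s : ℝ) (k : ℤ) (i : Fin n) :
    pcoef (fun x => w (x + s)) k i = Complex.exp (Complex.I * (k * s : ℝ)) * pcoef w k i := by
  set F : ℝ → ℂ := fun x => Complex.exp (-Complex.I * k * x) * (w x i : ℂ) with hF
  have hFp : Function.Periodic F (2 * π) := fun x => by
    have : Complex.exp (-Complex.I * k * (x + 2 * π : ℝ)) = Complex.exp (-Complex.I * k * x) := by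
      rw [Complex.exp_eq_exp_iff_exists_int]
      exact ⟨-k, by push_cast; ring⟩
    simp only [hF, this, hp x]
  have h1 : ∀ x : ℝ, Complex.exp (-Complex.I * k * x) * (w (x + s) i : ℂ) =
      Complex.exp (Complex.I * (k * s : ℝ)) * F (x + s) := fun x => by
    simp only [hF]
    rw [← mul_assoc, ← Complex.exp_add]
    congr 2
    push_cast
    ring
  have h2 : ∫ x in (0 : ℝ)..(2 * π), F (x + s) = ∫ x in (0 : ℝ)..(2 * π), F x := by
    rw [intervalIntegral.integral_comp_add_right]
    simpa only [zero_add, add_comm s] using hFp.intervalIntegral_add_eq s 0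
  simp only [pcoef, h1, intervalIntegral.integral_const_mul, h2]
  ring

theorem pcoef_sub {n : ℕ} {v w : ℝ → EuclideanSpace ℝ (Fin n)} (hv : Continuous v)
    (hw : Continuous w) (k : ℤ) (i : Fin n) :
    pcoef (fun x => v x - w x) k i = pcoef v k i - pcoef w k i := by
  simp only [pcoef]
  rw [← mul_sub, ← intervalIntegral.integral_sub]
  · simp only [PiLp.sub_apply, Complex.ofReal_sub, mul_sub]
  all_goals exact Continuous.intervalIntegrable (by fun_prop) _ _

theorem hasSum_sq_pcoef_shift_sub {n : ℕ} {w : ℝ → EuclideanSpace ℝ (Fin n)} (hw : Continuous w)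
    (hp : Function.Periodic w (2 * π)) (s : ℝ) :
    HasSum (fun k : ℤ => ‖Complex.exp (Complex.I * (k * s : ℝ)) - 1‖ ^ 2 *
        ∑ i, ‖pcoef w k i‖ ^ 2)
      ((2 * π)⁻¹ * ∫ x in (0 : ℝ)..(2 * π), ‖w (x + s) - w x‖ ^ 2) := by
  have hws : Continuous fun x => w (x + s) := by fun_prop
  convert hasSum_sq_pcoef (w := fun x => w (x + s) - w x) (hws.sub hw) using 2 with k
  rw [Finset.mul_sum]
  refine Finset.sum_congr rfl fun i _ => ?_
  rw [pcoef_sub hws hw, pcoef_comp_add hp, ← mul_pow, ← norm_mul, sub_one_mul]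

theorem lintegral_comp_mul_left {a : ℝ} (ha : a ≠ 0) (f : ℝ → ENNReal) :
    ∫⁻ x, f (a * x) = ENNReal.ofReal |a⁻¹| * ∫⁻ x, f x := by
  have h := (Homeomorph.mulLeft₀ a ha).measurableEmbedding.lintegral_map (μ := volume) f
  simp only [Homeomorph.coe_mulLeft₀] at h
  rw [← h, Real.map_volume_mul_left ha, lintegral_smul_measure, smul_eq_mul]

/-- The weight `|e^{ith} - 1|² |h|^{-1-2β}` at frequency `t` of the Gagliardo seminorm. -/
noncomputable def gagliardoWeight (β t h : ℝ) : ℝ :=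
  ‖Complex.exp (Complex.I * (t * h : ℝ)) - 1‖ ^ 2 * |h| ^ (-1 - 2 * β)

theorem gagliardoWeight_nonneg (β t h : ℝ) : 0 ≤ gagliardoWeight β t h := by
  unfold gagliardoWeight
  positivity

theorem measurable_gagliardoWeight (β t : ℝ) : Measurable (gagliardoWeight β t) := by
  unfold gagliardoWeight
  fun_prop

theorem lintegral_gagliardoWeight {β : ℝ} (hβ : 0 < β) (t : ℝ) :
    ∫⁻ h, ENNReal.ofReal (gagliardoWeight β t h) =
      ENNReal.ofReal (|t| ^ (2 * β)) * ∫⁻ h, ENNReal.ofReal (gagliardoWeight β 1 h) := by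
  rcases eq_or_ne t 0 with rfl | ht
  · simp [gagliardoWeight, hβ.ne']
  have ht' : 0 < |t| := abs_pos.2 ht
  have h1 (h : ℝ) : ENNReal.ofReal (gagliardoWeight β t h) =
      ENNReal.ofReal (|t| ^ (1 + 2 * β)) * ENNReal.ofReal (gagliardoWeight β 1 (t * h)) := by
    rw [← ENNReal.ofReal_mul (by positivity)]
    congr 1
    have : |t| ^ (1 + 2 * β) * |t| ^ (-1 - 2 * β) = 1 := by
      rw [← rpow_add ht']
      ring_nf
      exact rpow_zero _
    simp only [gagliardoWeight, one_mul, abs_mul]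
    rw [mul_rpow (abs_nonneg _) (abs_nonneg _)]
    linear_combination (-‖Complex.exp (Complex.I * (t * h : ℝ)) - 1‖ ^ 2 *
      |h| ^ (-1 - 2 * β)) * this
  simp only [h1]
  rw [lintegral_const_mul' _ _ ENNReal.ofReal_ne_top,
    lintegral_comp_mul_left ht fun x => ENNReal.ofReal (gagliardoWeight β 1 x), ← mul_assoc,
    ← ENNReal.ofReal_mul (by positivity)]
  congr 2
  rw [abs_inv, ← rpow_neg_one, ← rpow_add ht']
  ring_nf

theorem integrable_gagliardoWeight {β : ℝ} (hβ : 0 < β) (hβ1 : β < 1) :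
    Integrable (gagliardoWeight β 1) := by
  have hneg (h : ℝ) : gagliardoWeight β 1 (-h) = gagliardoWeight β 1 h := by
    simp [gagliardoWeight, Complex.norm_exp_I_mul_ofReal_sub_one, neg_div, -Complex.ofReal_neg]
  suffices h : IntegrableOn (gagliardoWeight β 1) (Set.Ioi 0) by
    rw [← integrableOn_univ, ← Set.Iic_union_Ioi (a := (0 : ℝ))]
    refine IntegrableOn.union ?_ h
    have h' : IntegrableOn (gagliardoWeight β 1) (Set.Ici (-0)) := by
      rwa [neg_zero, integrableOn_Ici_iff_integrableOn_Ioi]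
    simpa only [hneg] using h'.comp_neg_Iic
  rw [← Set.Ioc_union_Ioi_eq_Ioi zero_le_one]
  refine IntegrableOn.union ?_ ?_
  · have h1 : IntegrableOn (fun h : ℝ => h ^ (1 - 2 * β)) (Set.Ioc 0 1) := by
      rw [← intervalIntegrable_iff_integrableOn_Ioc_of_le zero_le_one]
      exact intervalIntegral.intervalIntegrable_rpow' (by linarith)
    refine h1.mono' (measurable_gagliardoWeight β 1).aestronglyMeasurable ?_
    refine (ae_restrict_iff' measurableSet_Ioc).2 (.of_forall fun h hh => ?_)
    rw [norm_of_nonneg (gagliardoWeight_nonneg _ _ _), gagliardoWeight, one_mul, abs_of_pos hh.1]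
    have : h ^ (1 - 2 * β) = h ^ 2 * h ^ (-1 - 2 * β) := by
      rw [← rpow_natCast, ← rpow_add hh.1]
      push_cast
      ring_nf
    rw [this]
    have h0 : 0 ≤ h ^ (-1 - 2 * β) := rpow_nonneg hh.1.le _
    gcongr
    exact norm_exp_I_mul_ofReal_sub_one_le.trans_eq (norm_of_nonneg hh.1.le)
  · refine ((integrableOn_Ioi_rpow_of_lt (a := -1 - 2 * β) (by linarith) one_pos).const_mul
      4).mono' (measurable_gagliardoWeight β 1).aestronglyMeasurable ?_
    refine (ae_restrict_iff' measurableSet_Ioi).2 (.of_forall fun h hh => ?_)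
    have hh : 0 < h := one_pos.trans hh
    rw [norm_of_nonneg (gagliardoWeight_nonneg _ _ _), gagliardoWeight, one_mul, abs_of_pos hh]
    gcongr
    have : ‖Complex.exp (Complex.I * h) - 1‖ ≤ 2 := by
      refine (norm_sub_le _ _).trans ?_
      rw [Complex.norm_exp_I_mul_ofReal, norm_one]
      norm_num
    nlinarith [norm_nonneg (Complex.exp (Complex.I * h) - 1)]

theorem lintegral_gagliardoWeight_ne_top {β : ℝ} (hβ : 0 < β) (hβ1 : β < 1) :
    ∫⁻ h, ENNReal.ofReal (gagliardoWeight β 1 h) ≠ ⊤ := by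
  exact (integrable_gagliardoWeight hβ hβ1).lintegral_lt_top.ne

theorem lintegral_gagliardoWeight_ne_zero (β : ℝ) :
    ∫⁻ h, ENNReal.ofReal (gagliardoWeight β 1 h) ≠ 0 := by
  rw [← pos_iff_ne_zero, lintegral_pos_iff_support (measurable_gagliardoWeight β 1).ennreal_ofReal]
  refine lt_of_lt_of_le (b := volume (Set.Ioo (0 : ℝ) 1)) (by simp) (measure_mono fun h hh => ?_)
  rw [Function.mem_support, ENNReal.ofReal_ne_zero_iff, gagliardoWeight, one_mul]
  have h1 : 0 < |h| := abs_pos.2 hh.1.ne'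
  have h2 : 0 < sin (h / 2) :=
    sin_pos_of_pos_of_lt_pi (by linarith [hh.1]) (by linarith [hh.2, pi_gt_three])
  rw [Complex.norm_exp_I_mul_ofReal_sub_one]
  have : 0 < ‖2 * sin (h / 2)‖ := norm_pos_iff.2 (by positivity)
  positivity

/-- If `w` is Lipschitz as a function of `u`, its homogeneous `H^β` seminorm is controlled by that
of `u`. -/
theorem tsum_homogeneous_le {n m : ℕ} {β L : ℝ} (hβ : 0 < β) (hβ1 : β < 1)
    {w : ℝ → EuclideanSpace ℝ (Fin n)} {u : ℝ → EuclideanSpace ℝ (Fin m)}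
    (hw : Continuous w) (hu : Continuous u)
    (hwp : Function.Periodic w (2 * π)) (hup : Function.Periodic u (2 * π))
    (hL : ∀ x y, ‖w x - w y‖ ≤ L * ‖u x - u y‖) :
    ∑' k : ℤ, ENNReal.ofReal (|(k : ℝ)| ^ (2 * β) * ∑ i, ‖pcoef w k i‖ ^ 2) ≤
      ENNReal.ofReal (L ^ 2) *
        ∑' k : ℤ, ENNReal.ofReal (|(k : ℝ)| ^ (2 * β) * ∑ i, ‖pcoef u k i‖ ^ 2) := by
  set c := ∫⁻ h, ENNReal.ofReal (gagliardoWeight β 1 h)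
  have key {d : ℕ} {v : ℝ → EuclideanSpace ℝ (Fin d)} (hv : Continuous v)
      (hvp : Function.Periodic v (2 * π)) :
      c * ∑' k : ℤ, ENNReal.ofReal (|(k : ℝ)| ^ (2 * β) * ∑ i, ‖pcoef v k i‖ ^ 2) =
      ∫⁻ h, ENNReal.ofReal (|h| ^ (-1 - 2 * β) *
        ((2 * π)⁻¹ * ∫ x in (0 : ℝ)..(2 * π), ‖v (x + h) - v x‖ ^ 2)) := by
    have hterm (k : ℤ) :
        c * ENNReal.ofReal (|(k : ℝ)| ^ (2 * β) * ∑ i, ‖pcoef v k i‖ ^ 2) =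
        ∫⁻ h, ENNReal.ofReal (gagliardoWeight β k h * ∑ i, ‖pcoef v k i‖ ^ 2) := by
      simp only [ENNReal.ofReal_mul (gagliardoWeight_nonneg _ _ _)]
      rw [lintegral_mul_const' _ _ ENNReal.ofReal_ne_top, lintegral_gagliardoWeight hβ,
        ENNReal.ofReal_mul (by positivity)]
      ring
    rw [← ENNReal.tsum_mul_left]
    simp only [hterm]
    rw [← lintegral_tsum fun k : ℤ =>
      ((measurable_gagliardoWeight β k).mul_const _).ennreal_ofReal.aemeasurable]
    refine lintegral_congr fun h => ?_
    have hs := (hasSum_sq_pcoef_shift_sub hv hvp h).mul_left (|h| ^ (-1 - 2 * β))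
    rw [← hs.tsum_eq, ENNReal.ofReal_tsum_of_nonneg (fun k => by positivity) hs.summable]
    refine tsum_congr fun k => ?_
    rw [gagliardoWeight]
    ring_nf
  have hc0 : c ≠ 0 := lintegral_gagliardoWeight_ne_zero β
  have hct : c ≠ ⊤ := lintegral_gagliardoWeight_ne_top hβ hβ1
  rw [← ENNReal.mul_le_mul_iff_right hc0 hct, mul_left_comm, key hw hwp, key hu hup,
    ← lintegral_const_mul' _ _ ENNReal.ofReal_ne_top]
  refine lintegral_mono fun h => ?_
  rw [← ENNReal.ofReal_mul (by positivity)]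
  refine ENNReal.ofReal_le_ofReal ?_
  have : ∫ x in (0 : ℝ)..(2 * π), ‖w (x + h) - w x‖ ^ 2 ≤
      L ^ 2 * ∫ x in (0 : ℝ)..(2 * π), ‖u (x + h) - u x‖ ^ 2 := by
    rw [← intervalIntegral.integral_const_mul]
    refine intervalIntegral.integral_mono_on two_pi_pos.le
      (Continuous.intervalIntegrable (by fun_prop) _ _)
      (Continuous.intervalIntegrable (by fun_prop) _ _) fun x _ => ?_
    rw [← mul_pow]
    gcongr
    exact hL _ _
  calc _ ≤ |h| ^ (-1 - 2 * β) * ((2 * π)⁻¹ *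
        (L ^ 2 * ∫ x in (0 : ℝ)..(2 * π), ‖u (x + h) - u x‖ ^ 2)) := by gcongr
    _ = _ := by ring

theorem norm_exp_I_mul_sub_one_sub_le {β : ℝ} (hβ : β ∈ Set.Icc (0 : ℝ) 1) (s : ℝ) :
    ‖Complex.exp (Complex.I * s) - 1 - Complex.I * s‖ ≤ 2 * |s| ^ (1 + β) := by
  have hn : ‖Complex.I * s‖ = |s| := by simp
  rcases le_total |s| 1 with hs | hs
  · refine (Complex.norm_exp_sub_one_sub_id_le (hn.trans_le hs)).trans ?_
    rw [hn, ← rpow_natCast]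
    have : |s| ^ ((2 : ℕ) : ℝ) ≤ |s| ^ (1 + β) :=
      rpow_le_rpow_of_exponent_ge_of_imp (abs_nonneg _) hs (by push_cast; linarith [hβ.2])
        (fun _ h => by norm_num at h)
    linarith [rpow_nonneg (abs_nonneg s) (1 + β)]
  · calc _ ≤ ‖Complex.exp (Complex.I * s) - 1‖ + ‖Complex.I * s‖ := norm_sub_le _ _
      _ ≤ |s| + |s| := add_le_add norm_exp_I_mul_ofReal_sub_one_le hn.le
      _ = 2 * |s| ^ (1 : ℝ) := by rw [rpow_one]; ring
      _ ≤ _ := by gcongr; linarith [hβ.1]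

/-- The Fourier transform of the signed measure `μp - μn`. -/
noncomputable def signedFourier (μp μn : Measure ℝ) (t : ℝ) : ℂ :=
  (∫ y, Complex.exp (Complex.I * (t * y : ℝ)) ∂μp) - ∫ y, Complex.exp (Complex.I * (t * y : ℝ)) ∂μn

theorem integrable_exp_I_mul (μ : Measure ℝ) [IsFiniteMeasure μ] (t : ℝ) :
    Integrable (fun y : ℝ => Complex.exp (Complex.I * (t * y : ℝ))) μ :=
  Integrable.of_bound (by fun_prop) 1 (.of_forall fun y => by
    rw [Complex.norm_exp_I_mul_ofReal])

theorem integrable_abs_rpow_of_moment {μ : Measure ℝ} [IsFiniteMeasure μ]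
    (h : Integrable (fun y : ℝ => |y| ^ 4) μ) {p : ℝ} (hp : p ∈ Set.Icc (0 : ℝ) 4) :
    Integrable (fun y : ℝ => |y| ^ p) μ := by
  refine ((integrable_const (1 : ℝ)).add h).mono' (by fun_prop (disch := exact hp.1))
    (.of_forall fun y => ?_)
  rw [norm_of_nonneg (by positivity), Pi.add_apply]
  rcases le_total |y| 1 with hy | hy
  · have := rpow_le_one (abs_nonneg y) hy hp.1
    have : 0 ≤ |y| ^ 4 := by positivity
    linarith
  · have h4 := rpow_le_rpow_of_exponent_le hy hp.2
    rw [show (4 : ℝ) = ((4 : ℕ) : ℝ) by norm_num, rpow_natCast] at h4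
    linarith

theorem norm_signedFourier_sub_le {β : ℝ} (hβ : β ∈ Set.Icc (0 : ℝ) 1) {μp μn : Measure ℝ}
    [IsFiniteMeasure μp] [IsFiniteMeasure μn] (hzero : μp Set.univ = μn Set.univ)
    (hmean : (∫ y, y ∂μp) - ∫ y, y ∂μn = 1)
    (hmom : Integrable (fun y : ℝ => |y| ^ 4) (μp + μn)) (t : ℝ) :
    ‖signedFourier μp μn t - Complex.I * t‖ ≤
      2 * |t| ^ (1 + β) * ∫ y, |y| ^ (1 + β) ∂(μp + μn) := by
  obtain ⟨hp, hn⟩ := integrable_add_measure.1 hmom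
  have hβ' : 1 + β ∈ Set.Icc (0 : ℝ) 4 := ⟨by linarith [hβ.1], by linarith [hβ.2]⟩
  have hid {μ : Measure ℝ} [IsFiniteMeasure μ] (h : Integrable (fun y : ℝ => |y| ^ 4) μ) :
      Integrable (fun y : ℝ => y) μ := by
    have := integrable_abs_rpow_of_moment h (p := 1) (by norm_num)
    simp only [rpow_one] at this
    exact (integrable_norm_iff (by fun_prop)).1 this
  have hsplit {μ : Measure ℝ} [IsFiniteMeasure μ] (h : Integrable (fun y : ℝ => |y| ^ 4) μ) :
      ∫ y, (Complex.exp (Complex.I * (t * y : ℝ)) - 1 - Complex.I * (t * y : ℝ)) ∂μ =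
        (∫ y, Complex.exp (Complex.I * (t * y : ℝ)) ∂μ) - (μ.real Set.univ : ℂ) -
          Complex.I * t * (∫ y, y ∂μ : ℝ) := by
    have h2 : Integrable (fun y : ℝ => Complex.I * ((t * y : ℝ) : ℂ)) μ :=
      (((hid h).const_mul t).ofReal).const_mul _
    rw [integral_sub (f := fun y : ℝ => Complex.exp (Complex.I * (t * y : ℝ)) - 1)
        ((integrable_exp_I_mul μ t).sub (integrable_const _)) h2,
      integral_sub (integrable_exp_I_mul μ t) (integrable_const _), integral_const_mul,
      integral_complex_ofReal, integral_const_mul]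
    simp [mul_assoc]
  have hbound {μ : Measure ℝ} [IsFiniteMeasure μ] (h : Integrable (fun y : ℝ => |y| ^ 4) μ) :
      ‖∫ y, (Complex.exp (Complex.I * (t * y : ℝ)) - 1 - Complex.I * (t * y : ℝ)) ∂μ‖ ≤
        2 * |t| ^ (1 + β) * ∫ y, |y| ^ (1 + β) ∂μ := by
    rw [← integral_const_mul]
    refine norm_integral_le_of_norm_le
      ((integrable_abs_rpow_of_moment h hβ').const_mul _) (.of_forall fun y => ?_)
    refine (norm_exp_I_mul_sub_one_sub_le hβ _).trans_eq ?_
    rw [abs_mul, mul_rpow (abs_nonneg _) (abs_nonneg _), mul_assoc]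
  have hz : μp.real Set.univ = μn.real Set.univ := by simp only [Measure.real, hzero]
  have hm : ((∫ y, y ∂μp : ℝ) : ℂ) - (∫ y, y ∂μn : ℝ) = 1 := by exact_mod_cast hmean
  have heq : signedFourier μp μn t - Complex.I * t =
      (∫ y, (Complex.exp (Complex.I * (t * y : ℝ)) - 1 - Complex.I * (t * y : ℝ)) ∂μp) -
      ∫ y, (Complex.exp (Complex.I * (t * y : ℝ)) - 1 - Complex.I * (t * y : ℝ)) ∂μn := by
    rw [hsplit hp, hsplit hn, hz, signedFourier]
    linear_combination (Complex.I * t) * hm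
  rw [heq, integral_add_measure (integrable_abs_rpow_of_moment hp hβ')
    (integrable_abs_rpow_of_moment hn hβ'), mul_add]
  exact (norm_sub_le _ _).trans (add_le_add (hbound hp) (hbound hn))

theorem pcoef_average {n : ℕ} (μ : Measure ℝ) [IsFiniteMeasure μ]
    {w : ℝ → EuclideanSpace ℝ (Fin n)} (hw : Continuous w) (hwp : Function.Periodic w (2 * π))
    {M : ℝ} (hM : ∀ x, ‖w x‖ ≤ M) (ε : ℝ) (k : ℤ) (i : Fin n) :
    pcoef (fun x => ∫ y, w (x + ε * y) ∂μ) k i =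
      (∫ y, Complex.exp (Complex.I * ((ε * k) * y : ℝ)) ∂μ) * pcoef w k i := by
  have hint (x : ℝ) : Integrable (fun y => w (x + ε * y)) μ :=
    Integrable.of_bound (by fun_prop) M (.of_forall fun y => hM _)
  have h1 (x : ℝ) : (((∫ y, w (x + ε * y) ∂μ) i : ℝ) : ℂ) = ∫ y, (w (x + ε * y) i : ℂ) ∂μ := by
    rw [integral_complex_ofReal]
    congr 1
    exact ((EuclideanSpace.proj (𝕜 := ℝ) i).integral_comp_comm (hint x)).symm
  have hfin : IsFiniteMeasure (volume.restrict (Set.uIoc 0 (2 * π))) := ⟨by simp [Set.uIoc]⟩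
  have hswap := intervalIntegral_integral_swap (a := 0) (b := 2 * π) (μ := μ)
    (f := fun x y : ℝ => Complex.exp (-Complex.I * k * x) * (w (x + ε * y) i : ℂ))
    (Integrable.of_bound (by fun_prop) M (.of_forall fun p => by
      have : ‖Complex.exp (-Complex.I * k * p.1)‖ = 1 := by
        rw [Complex.norm_exp]
        simp
      simp only [Function.uncurry, norm_mul, this, one_mul, Complex.norm_real]
      exact (PiLp.norm_apply_le _ i).trans (hM _)))
  have h2 (y : ℝ) : (1 / (2 * π) : ℝ) * ∫ x in (0 : ℝ)..(2 * π),
      Complex.exp (-Complex.I * k * x) * (w (x + ε * y) i : ℂ) =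
      Complex.exp (Complex.I * ((ε * k) * y : ℝ)) * pcoef w k i := by
    rw [show ε * k * y = k * (ε * y) by ring]
    exact pcoef_comp_add hwp (ε * y) k i
  rw [pcoef]
  simp only [h1, ← integral_const_mul]
  rw [hswap, ← integral_const_mul, ← integral_mul_const]
  exact integral_congr_ae (.of_forall h2)

theorem pcoef_Deps {n : ℕ} (μp μn : Measure ℝ) [IsFiniteMeasure μp] [IsFiniteMeasure μn]
    {w : ℝ → EuclideanSpace ℝ (Fin n)} (hw : Continuous w) (hwp : Function.Periodic w (2 * π))
    {M : ℝ} (hM : ∀ x, ‖w x‖ ≤ M) (ε : ℝ) (k : ℤ) (i : Fin n) :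
    pcoef (Deps μp μn ε w) k i = (ε⁻¹ : ℝ) * signedFourier μp μn (ε * k) * pcoef w k i := by
  have hcont (μ : Measure ℝ) [IsFiniteMeasure μ] : Continuous fun x => ∫ y, w (x + ε * y) ∂μ :=
    continuous_of_dominated (fun x => by fun_prop) (fun x => .of_forall fun y => hM _)
      (integrable_const M) (.of_forall fun y => by fun_prop)
  have hsmul (v : ℝ → EuclideanSpace ℝ (Fin n)) :
      pcoef (fun x => ε⁻¹ • v x) k i = (ε⁻¹ : ℝ) * pcoef v k i := by
    simp only [pcoef, PiLp.smul_apply, smul_eq_mul, Complex.ofReal_mul,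
      mul_left_comm _ ((ε⁻¹ : ℝ) : ℂ), intervalIntegral.integral_const_mul]
  unfold Deps
  rw [hsmul, pcoef_sub (hcont μp) (hcont μn), pcoef_average μp hw hwp hM,
    pcoef_average μn hw hwp hM, signedFourier]
  ring

theorem le_C1normOn {n : ℕ} {G : EuclideanSpace ℝ (Fin n) → EuclideanSpace ℝ (Fin n)}
    (hG : ContDiff ℝ 1 G) {R : ℝ} {x : EuclideanSpace ℝ (Fin n)} (hx : ‖x‖ ≤ R) :
    ‖G x‖ + ‖fderiv ℝ G x‖ ≤ C1normOn G R := by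
  have hcont : Continuous fun x => ‖G x‖ + ‖fderiv ℝ G x‖ :=
    hG.continuous.norm.add (hG.continuous_fderiv one_ne_zero).norm
  obtain ⟨B, hB⟩ := (isCompact_closedBall (0 : EuclideanSpace ℝ (Fin n)) R).bddAbove_image
    hcont.continuousOn
  have hB' (y : EuclideanSpace ℝ (Fin n)) (hy : ‖y‖ ≤ R) : ‖G y‖ + ‖fderiv ℝ G y‖ ≤ B :=
    hB ⟨y, by simpa using hy, rfl⟩
  have hB0 : 0 ≤ B := le_trans (by positivity) (hB' x hx)
  refine le_trans ?_ (le_ciSup (f := fun y => ⨆ _ : y ∈ {y : EuclideanSpace ℝ (Fin n) | ‖y‖ ≤ R},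
    (‖G y‖ + ‖fderiv ℝ G y‖)) ⟨B, ?_⟩ x)
  · exact (ciSup_pos (f := fun _ : x ∈ {y : EuclideanSpace ℝ (Fin n) | ‖y‖ ≤ R} =>
      ‖G x‖ + ‖fderiv ℝ G x‖) hx).ge
  · rintro _ ⟨y, rfl⟩
    exact Real.iSup_le (fun hy => hB' y hy) hB0

theorem C1normOn_nonneg {n : ℕ} (G : EuclideanSpace ℝ (Fin n) → EuclideanSpace ℝ (Fin n))
    (R : ℝ) : 0 ≤ C1normOn G R :=
  Real.iSup_nonneg fun _ => Real.iSup_nonneg fun _ => by positivity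

theorem norm_comp_sub_le_C1normOn {n : ℕ}
    {G : EuclideanSpace ℝ (Fin n) → EuclideanSpace ℝ (Fin n)} (hG : ContDiff ℝ 1 G) {R : ℝ}
    {x y : EuclideanSpace ℝ (Fin n)} (hx : ‖x‖ ≤ R) (hy : ‖y‖ ≤ R) :
    ‖G x - G y‖ ≤ C1normOn G R * ‖x - y‖ := by
  refine (convex_closedBall (0 : EuclideanSpace ℝ (Fin n)) R).norm_image_sub_le_of_norm_fderiv_le
    (𝕜 := ℝ) (fun z _ => (hG.differentiable one_ne_zero) z) (fun z hz => ?_)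
    (by simpa using hy) (by simpa using hx)
  exact (le_add_of_nonneg_left (norm_nonneg _)).trans (le_C1normOn hG (by simpa using hz))

theorem tsum_ofReal_pcoef_le {n : ℕ} {w : ℝ → EuclideanSpace ℝ (Fin n)} (hw : Continuous w)
    {M : ℝ} (hM : ∀ x, ‖w x‖ ≤ M) :
    ∑' k : ℤ, ENNReal.ofReal (∑ i, ‖pcoef w k i‖ ^ 2) ≤ ENNReal.ofReal (M ^ 2) := by
  have h := hasSum_sq_pcoef hw
  rw [← ENNReal.ofReal_tsum_of_nonneg (fun k => by positivity) h.summable, h.tsum_eq]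
  refine ENNReal.ofReal_le_ofReal ?_
  rw [inv_mul_le_iff₀ two_pi_pos]
  calc _ ≤ ∫ x in (0 : ℝ)..(2 * π), M ^ 2 :=
        intervalIntegral.integral_mono_on two_pi_pos.le
          (Continuous.intervalIntegrable (by fun_prop) _ _) intervalIntegrable_const
          fun x _ => by gcongr; exact hM x
    _ = _ := by simp

theorem tsum_homogeneous_comp_le {n : ℕ} {β : ℝ} (hβ : β ∈ Set.Ico (0 : ℝ) 1)
    {u : ℝ → EuclideanSpace ℝ (Fin n)}
    {G : EuclideanSpace ℝ (Fin n) → EuclideanSpace ℝ (Fin n)} (hG : ContDiff ℝ 1 G)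
    (hu : Continuous u) (hup : Function.Periodic u (2 * π)) {R : ℝ} (hR : ∀ x, ‖u x‖ ≤ R)
    (hs : Summable (fun k : ℤ => (1 + (k : ℝ) ^ 2) ^ β * ∑ i, ‖pcoef u k i‖ ^ 2)) :
    ∑' k : ℤ, ENNReal.ofReal (|(k : ℝ)| ^ (2 * β) * ∑ i, ‖pcoef (fun z => G (u z)) k i‖ ^ 2) ≤
      ENNReal.ofReal (C1normOn G R ^ 2 * (1 + fnSobSq β u)) := by
  have hw : Continuous fun z => G (u z) := hG.continuous.comp hu
  have hu0 : 0 ≤ fnSobSq β u := tsum_nonneg fun k => by positivity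
  rcases hβ.1.eq_or_lt with rfl | hβ0
  · simp only [mul_zero, rpow_zero, one_mul]
    refine (tsum_ofReal_pcoef_le hw fun x =>
      (le_add_of_nonneg_right (norm_nonneg _)).trans (le_C1normOn hG (hR x))).trans
        (ENNReal.ofReal_le_ofReal (le_mul_of_one_le_right (sq_nonneg _) (by linarith)))
  · have hwp : Function.Periodic (fun z => G (u z)) (2 * π) := fun x => by simp only [hup x]
    refine (tsum_homogeneous_le hβ0 hβ.2 hw hu hwp hup fun x y =>
      norm_comp_sub_le_C1normOn hG (hR x) (hR y)).trans ?_
    rw [ENNReal.ofReal_mul (sq_nonneg _)]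
    gcongr
    calc _ ≤ ∑' k : ℤ, ENNReal.ofReal ((1 + (k : ℝ) ^ 2) ^ β * ∑ i, ‖pcoef u k i‖ ^ 2) := by
          gcongr with k
          rw [rpow_mul (abs_nonneg _), rpow_two, sq_abs]
          have := hβ.1
          gcongr
          linarith
      _ = ENNReal.ofReal (fnSobSq β u) :=
          (ENNReal.ofReal_tsum_of_nonneg (fun k => by positivity) hs).symm
      _ ≤ _ := ENNReal.ofReal_le_ofReal (by linarith)

theorem norm_multiplier_sq_le {β κ : ℝ} (hβ : 0 ≤ β) {ε : ℝ} (hε : 0 < ε) {k : ℤ} {z : ℂ}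
    (hz : ‖z - Complex.I * (ε * k : ℝ)‖ ≤ κ * |ε * k| ^ (1 + β)) :
    (1 + (k : ℝ) ^ 2) ^ (-1 : ℝ) * ‖(ε⁻¹ : ℝ) * z - Complex.I * k‖ ^ 2 ≤
      (κ * ε ^ β) ^ 2 * |(k : ℝ)| ^ (2 * β) := by
  have h1 : ‖(ε⁻¹ : ℝ) * z - Complex.I * k‖ ≤ κ * ε ^ β * |(k : ℝ)| ^ (1 + β) := by
    have h2 : (ε⁻¹ : ℝ) * z - Complex.I * k = (ε⁻¹ : ℝ) * (z - Complex.I * (ε * k : ℝ)) := by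
      have : (ε : ℂ) ≠ 0 := by exact_mod_cast hε.ne'
      push_cast
      field_simp
    rw [h2, norm_mul, Complex.norm_real, norm_of_nonneg (inv_pos.2 hε).le, inv_mul_le_iff₀ hε]
    refine hz.trans_eq ?_
    rw [abs_mul, mul_rpow (abs_nonneg _) (abs_nonneg _), abs_of_pos hε, rpow_add hε, rpow_one]
    ring
  have h3 : (|(k : ℝ)| ^ (1 + β)) ^ 2 = (k : ℝ) ^ 2 * |(k : ℝ)| ^ (2 * β) := by
    rw [← rpow_natCast (|(k : ℝ)| ^ (1 + β)), ← rpow_mul (abs_nonneg _), ← sq_abs (k : ℝ),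
      ← rpow_natCast |(k : ℝ)| 2, ← rpow_add_of_nonneg (abs_nonneg _) (by norm_num) (by linarith)]
    push_cast
    ring_nf
  rw [rpow_neg_one, inv_mul_le_iff₀ (by positivity)]
  calc _ ≤ (κ * ε ^ β * |(k : ℝ)| ^ (1 + β)) ^ 2 := by gcongr
    _ = (k : ℝ) ^ 2 * ((κ * ε ^ β) ^ 2 * |(k : ℝ)| ^ (2 * β)) := by rw [mul_pow, h3]; ring
    _ ≤ _ := by gcongr; linarith

theorem tsum_le_of_tsum_ofReal_le {ι : Type*} {f : ι → ℝ} (hf : ∀ i, 0 ≤ f i) {B : ℝ}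
    (hB : 0 ≤ B) (h : ∑' i, ENNReal.ofReal (f i) ≤ ENNReal.ofReal B) : ∑' i, f i ≤ B := by
  refine Real.tsum_le_of_sum_le hf fun s => ?_
  rw [← ENNReal.ofReal_le_ofReal_iff hB, ENNReal.ofReal_sum_of_nonneg fun i _ => hf i]
  exact (ENNReal.sum_le_tsum s).trans h

/-- `‖D_ε G(u) - ∂_x G(u)‖_{-1} ≤ C ε^β ‖G_u‖_{C¹} (1 + ‖u‖_β)`, with `∂_x` acting as
the Fourier multiplier `ik`. -/
theorem stmt_9 (β : ℝ) (hβ : β ∈ Set.Ico (0 : ℝ) 1) (n : ℕ)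
    (μp μn : Measure ℝ) [IsFiniteMeasure μp] [IsFiniteMeasure μn]
    (hzero : μp Set.univ = μn Set.univ)
    (hmean : (∫ y, y ∂μp) - ∫ y, y ∂μn = 1)
    (hmom : Integrable (fun y : ℝ => |y| ^ 4) (μp + μn)) :
    ∃ C > 0, ∀ ε ∈ Set.Ioc (0 : ℝ) 1,
      ∀ (u : ℝ → EuclideanSpace ℝ (Fin n))
        (G : EuclideanSpace ℝ (Fin n) → EuclideanSpace ℝ (Fin n)),
      Continuous u → Function.Periodic u (2 * π) →
      Summable (fun k : ℤ => (1 + (k : ℝ) ^ 2) ^ β * ∑ i, ‖pcoef u k i‖ ^ 2) →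
      ContDiff ℝ 1 G →
      Real.sqrt (∑' k : ℤ, (1 + (k : ℝ) ^ 2) ^ (-1 : ℝ) *
          ∑ i, ‖pcoef (Deps μp μn ε fun z => G (u z)) k i
              - Complex.I * k * pcoef (fun z => G (u z)) k i‖ ^ 2) ≤
        C * ε ^ β * C1normOn G (⨆ x, ‖u x‖) * (1 + Real.sqrt (fnSobSq β u)) := by
  set A := ∫ y, |y| ^ (1 + β) ∂(μp + μn)
  have hA0 : 0 ≤ A := integral_nonneg fun y => by positivity
  refine ⟨2 * A + 1, by positivity, ?_⟩
  intro ε hε u G hu hup hs hG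
  have hw : Continuous fun z => G (u z) := hG.continuous.comp hu
  have hwp : Function.Periodic (fun z => G (u z)) (2 * π) := fun x => by simp only [hup x]
  have hbdd : BddAbove (Set.range fun x => ‖u x‖) := by
    have hnp : Function.Periodic (fun x => ‖u x‖) (2 * π) := fun x => by simp only [hup x]
    exact (hnp.isBounded_of_continuous two_pi_pos.ne' hu.norm).bddAbove
  set R := ⨆ x, ‖u x‖
  have hR (x : ℝ) : ‖u x‖ ≤ R := le_ciSup hbdd x
  set N := C1normOn G R
  have hN0 : 0 ≤ N := C1normOn_nonneg G R
  have hu0 : 0 ≤ fnSobSq β u := tsum_nonneg fun k => by positivity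
  have hM (x : ℝ) : ‖G (u x)‖ ≤ N :=
    (le_add_of_nonneg_right (norm_nonneg _)).trans (le_C1normOn hG (hR x))
  have hεβ : 0 ≤ ε ^ β := rpow_nonneg hε.1.le _
  refine Real.sqrt_le_iff.2 ⟨by positivity, ?_⟩
  have hterm (k : ℤ) : (1 + (k : ℝ) ^ 2) ^ (-1 : ℝ) *
      ∑ i, ‖pcoef (Deps μp μn ε fun z => G (u z)) k i
        - Complex.I * k * pcoef (fun z => G (u z)) k i‖ ^ 2 ≤
      ((2 * A) * ε ^ β) ^ 2 *
        (|(k : ℝ)| ^ (2 * β) * ∑ i, ‖pcoef (fun z => G (u z)) k i‖ ^ 2) := by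
    have hm := norm_multiplier_sq_le (κ := 2 * A) hβ.1 hε.1 (k := k)
      ((norm_signedFourier_sub_le ⟨hβ.1, hβ.2.le⟩ hzero hmean hmom (ε * k)).trans_eq
        (by ring))
    simp only [pcoef_Deps μp μn hw hwp hM, ← sub_mul, norm_mul _ (pcoef _ _ _),
      mul_pow _ ‖pcoef _ _ _‖, ← Finset.mul_sum]
    rw [← mul_assoc, ← mul_assoc]
    gcongr
  have hle := tsum_le_of_tsum_ofReal_le (fun k : ℤ => by positivity)
    (B := ((2 * A) * ε ^ β) ^ 2 * (N ^ 2 * (1 + fnSobSq β u))) (by positivity)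
    ((ENNReal.tsum_le_tsum fun k : ℤ => ENNReal.ofReal_le_ofReal (hterm k)).trans (by
      simp only [ENNReal.ofReal_mul (sq_nonneg (2 * A * ε ^ β)), ENNReal.tsum_mul_left]
      gcongr
      exact tsum_homogeneous_comp_le hβ hG hu hup hR hs))
  refine hle.trans ?_
  have hsq : 1 + fnSobSq β u ≤ (1 + √(fnSobSq β u)) ^ 2 := by
    nlinarith [Real.sq_sqrt hu0, Real.sqrt_nonneg (fnSobSq β u)]
  calc _ ≤ ((2 * A + 1) * ε ^ β) ^ 2 * (N ^ 2 * (1 + √(fnSobSq β u)) ^ 2) := by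
        gcongr
        linarith
    _ = _ := by ring
end

section
/- Let ν > 0, let f : (0,∞) → [0,+∞] satisfy f(t) ≥ q for all t for some q ∈ (0,1], let h : (0,∞) → ℝ be bounded, and suppose the function g := h²/f (interpreted as 0 where f = +∞) is bounded and of bounded variation on (0,∞). Let 0 < γ < χ. For ε ∈ (0,1] and y ∈ ℝ define Λ_ε^y = Σ_{ε^{−γ} < k < ε^{−χ}, k ∈ ℕ} (1 − cos(εky)) h²(εk) / ( 2π ε (1 + ν k² f(εk)) ) and Λ^y = (1/(2πν)) ∫₀^∞ (1 − cos(yt)) h²(t) / (t² f(t)) dt. Then there exists a constant C > 0 (depending only on ν, q, γ, χ, the sup norms of h and g, and the total variation of g) such that |Λ_ε^y − Λ^y| ≤ C ( ε^{1−γ} y² + ε y² + ε^{χ−1} ) for all ε ∈ (0,1] and y ∈ ℝ. -/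
open MeasureTheory Real
open scoped ENNReal

/-- The function `g = h²/f`, interpreted as `0` where `f = +∞`. -/
noncomputable def gfun (f : ℝ → ℝ≥0∞) (h : ℝ → ℝ) (t : ℝ) : ℝ :=
  if f t = ⊤ then 0 else h t ^ 2 / (f t).toReal

open Set

theorem one_sub_cos_le (x : ℝ) : 1 - cos x ≤ x ^ 2 / 2 := by
  linarith [Real.one_sub_sq_div_two_le_cos (x := x)]

theorem abs_mul_sin_sub_le {s : ℝ} (hs : 0 < s) :
    |s * sin s - 2 * (1 - cos s)| * (1 + s ^ 2) ≤ 10 * s ^ 3 := by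
  rcases le_total s 1 with h | h
  · have h1 := Real.cos_bound (x := s) (by rwa [abs_of_pos hs])
    have h2 := Real.sin_bound (x := s) (by rwa [abs_of_pos hs])
    rw [abs_of_pos hs, abs_le] at h1 h2
    have h6 : s ^ 6 ≤ s ^ 4 := pow_le_pow_of_le_one hs.le h (by norm_num)
    have h43 : s ^ 4 ≤ s ^ 3 := pow_le_pow_of_le_one hs.le h (by norm_num)
    have hs2 : s ^ 2 ≤ 1 := pow_le_one₀ hs.le h
    have hm : |s * sin s - 2 * (1 - cos s)| ≤ s ^ 4 := by
      have h2a := mul_le_mul_of_nonneg_left h2.1 hs.le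
      have h2b := mul_le_mul_of_nonneg_left h2.2 hs.le
      have : 0 < s ^ 4 := by positivity
      rw [abs_le]
      constructor <;> nlinarith
    calc _ ≤ s ^ 4 * 2 := by gcongr; linarith
      _ ≤ _ := by have : 0 < s ^ 3 := by positivity
                  linarith
  · have hm : |s * sin s - 2 * (1 - cos s)| ≤ s + 4 := by
      rw [abs_le]
      constructor <;> nlinarith [Real.neg_one_le_sin s, Real.sin_le_one s, Real.neg_one_le_cos s,
        Real.cos_le_one s]
    calc _ ≤ (s + 4) * (1 + s ^ 2) := by gcongr
      _ ≤ (s + 4 * s) * (s ^ 2 + s ^ 2) := by gcongr <;> nlinarith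
      _ = _ := by ring

theorem hasDerivAt_one_sub_cos_div_sq {s : ℝ} (hs : 0 < s) :
    HasDerivAt (fun x => (1 - cos x) / x ^ 2) ((s * sin s - 2 * (1 - cos s)) / s ^ 3) s := by
  convert! ((hasDerivAt_cos s).const_sub 1).div (hasDerivAt_pow 2 s) (by positivity) using 1
  field_simp
  ring

theorem abs_one_sub_cos_div_sq_sub_le {s t : ℝ} (hs : 0 < s) (hst : s ≤ t) :
    |(1 - cos t) / t ^ 2 - (1 - cos s) / s ^ 2| ≤ 10 * (arctan t - arctan s) := by
  have hb : ∀ x : ℝ, 0 < x →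
      |(x * sin x - 2 * (1 - cos x)) / x ^ 3| ≤ 10 * (1 / (1 + x ^ 2)) := fun x hx => by
    rw [abs_div, abs_of_pos (show 0 < x ^ 3 by positivity), mul_one_div,
      div_le_div_iff₀ (by positivity) (by positivity)]
    exact abs_mul_sin_sub_le hx
  have hp : MonotoneOn (fun x => 10 * arctan x + (1 - cos x) / x ^ 2) (Ioi 0) := by
    have hd : ∀ x ∈ Ioi (0 : ℝ), HasDerivAt (fun x => 10 * arctan x + (1 - cos x) / x ^ 2)
        (10 * (1 / (1 + x ^ 2)) + (x * sin x - 2 * (1 - cos x)) / x ^ 3) x := fun x hx =>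
      ((hasDerivAt_arctan x).const_mul 10).add (hasDerivAt_one_sub_cos_div_sq hx)
    refine monotoneOn_of_hasDerivWithinAt_nonneg (convex_Ioi 0)
      (fun x hx => (hd x hx).continuousAt.continuousWithinAt)
      (fun x hx => (hd x (by simpa using hx)).hasDerivWithinAt) fun x hx => ?_
    linarith [(abs_le.1 (hb x (by simpa using hx))).1]
  have hm : MonotoneOn (fun x => 10 * arctan x - (1 - cos x) / x ^ 2) (Ioi 0) := by
    have hd : ∀ x ∈ Ioi (0 : ℝ), HasDerivAt (fun x => 10 * arctan x - (1 - cos x) / x ^ 2)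
        (10 * (1 / (1 + x ^ 2)) - (x * sin x - 2 * (1 - cos x)) / x ^ 3) x := fun x hx =>
      ((hasDerivAt_arctan x).const_mul 10).sub (hasDerivAt_one_sub_cos_div_sq hx)
    refine monotoneOn_of_hasDerivWithinAt_nonneg (convex_Ioi 0)
      (fun x hx => (hd x hx).continuousAt.continuousWithinAt)
      (fun x hx => (hd x (by simpa using hx)).hasDerivWithinAt) fun x hx => ?_
    linarith [(abs_le.1 (hb x (by simpa using hx))).2]
  have h1 := hp hs (hs.trans_le hst : t ∈ Ioi 0) hst
  have h2 := hm hs (hs.trans_le hst : t ∈ Ioi 0) hst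
  rw [abs_le]
  constructor <;> dsimp only at h1 h2 <;> linarith

theorem abs_one_sub_cos_mul_div_sq_sub_le (y : ℝ) {s t : ℝ} (hs : 0 < s) (hst : s ≤ t) :
    |(1 - cos (y * t)) / t ^ 2 - (1 - cos (y * s)) / s ^ 2| ≤
      10 * y ^ 2 * (arctan (|y| * t) - arctan (|y| * s)) := by
  rcases eq_or_ne y 0 with rfl | hy
  · simp
  have ht : 0 < t := hs.trans_le hst
  have hy' : 0 < |y| := abs_pos.2 hy
  have hscale : ∀ x : ℝ, 0 < x →
      (1 - cos (y * x)) / x ^ 2 = y ^ 2 * ((1 - cos (|y| * x)) / (|y| * x) ^ 2) := fun x hx => by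
    have : cos (|y| * x) = cos (y * x) := by
      rw [← Real.cos_abs (y * x), abs_mul, abs_of_pos hx]
    rw [this, mul_pow, sq_abs]
    field_simp
  rw [hscale t ht, hscale s hs, ← mul_sub, abs_mul, abs_of_nonneg (sq_nonneg y),
    mul_comm 10 (y ^ 2), mul_assoc]
  gcongr
  exact abs_one_sub_cos_div_sq_sub_le (by positivity) (by gcongr)

theorem one_sub_cos_mul_div_sq_nonneg (y t : ℝ) : 0 ≤ (1 - cos (y * t)) / t ^ 2 :=
  div_nonneg (by linarith [Real.cos_le_one (y * t)]) (sq_nonneg t)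

theorem one_sub_cos_mul_div_sq_le (y : ℝ) {t : ℝ} (ht : 0 < t) :
    (1 - cos (y * t)) / t ^ 2 ≤ y ^ 2 / 2 := by
  rw [div_le_iff₀ (by positivity)]
  linarith [one_sub_cos_le (y * t), mul_pow y t 2]

/-- Right-endpoint Riemann sums of a function whose increments are controlled by those of `W`. -/
theorem abs_sum_sub_intervalIntegral_le {F W : ℝ → ℝ} {ε : ℝ} (hε : 0 < ε)
    (hFW : ∀ s t, 0 < s → s ≤ t → |F t - F s| ≤ W t - W s)
    (hF : IntegrableOn F (Ioi 0)) {m n : ℕ} (hm : 1 ≤ m) (hmn : m ≤ n) :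
    |∑ k ∈ Finset.Ioc m n, ε * F (ε * k) - ∫ t in (ε * m)..(ε * n), F t| ≤
      ε * (W (ε * n) - W (ε * m)) := by
  have hint : ∀ a b : ℕ, IntervalIntegrable F volume (ε * a) (ε * b) := fun a b =>
    intervalIntegrable_iff.2 (hF.mono_set fun x hx => (le_min (by positivity) (by positivity) :
      (0 : ℝ) ≤ min (ε * a) (ε * b)).trans_lt hx.1)
  induction n, hmn using Nat.le_induction with
  | base => simp
  | succ n hmn ih =>
    have hn : (0 : ℝ) < n := by exact_mod_cast hm.trans hmn
    have hle : ε * n ≤ ε * (n + 1 : ℕ) := by gcongr; simp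
    have hlen : ε * (n + 1 : ℕ) - ε * n = ε := by push_cast; ring
    have hstep : |ε * F (ε * (n + 1 : ℕ)) - ∫ t in (ε * n)..(ε * (n + 1 : ℕ)), F t| ≤
        ε * (W (ε * (n + 1 : ℕ)) - W (ε * n)) := by
      have heq : ε * F (ε * (n + 1 : ℕ)) - ∫ t in (ε * n)..(ε * (n + 1 : ℕ)), F t =
          ∫ t in (ε * n)..(ε * (n + 1 : ℕ)), (F (ε * (n + 1 : ℕ)) - F t) := by
        rw [intervalIntegral.integral_sub intervalIntegrable_const (hint _ _),
          intervalIntegral.integral_const, hlen, smul_eq_mul]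
      rw [heq, ← Real.norm_eq_abs]
      refine (intervalIntegral.norm_integral_le_of_norm_le_const
        (C := W (ε * (n + 1 : ℕ)) - W (ε * n)) fun t ht => ?_).trans_eq ?_
      · rw [uIoc_of_le hle] at ht
        have h0 : 0 < ε * n := by positivity
        have h1 := hFW t _ (h0.trans ht.1) ht.2
        have h2 := (abs_nonneg _).trans (hFW (ε * n) t h0 ht.1.le)
        rw [Real.norm_eq_abs]
        linarith
      · rw [hlen, abs_of_pos hε, mul_comm]
    rw [← Finset.insert_Ioc_right_eq_Ioc_add_one (by omega), Finset.sum_insert (by simp),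
      ← intervalIntegral.integral_add_adjacent_intervals (hint m n) (hint n (n + 1))]
    calc _ = |(ε * F (ε * (n + 1 : ℕ)) - ∫ t in (ε * n)..(ε * (n + 1 : ℕ)), F t) +
          (∑ k ∈ Finset.Ioc m n, ε * F (ε * k) - ∫ t in (ε * m)..(ε * n), F t)| := by
            congr 1; ring
      _ ≤ _ := abs_add_le _ _
      _ ≤ _ := add_le_add hstep ih
      _ = _ := by ring

theorem abs_one_sub_cos_mul_mul_div_sq_le {g : ℝ → ℝ} {B : ℝ} (hg : ∀ t > 0, |g t| ≤ B) (y : ℝ)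
    {t : ℝ} (ht : 0 < t) : |(1 - cos (y * t)) * g t / t ^ 2| ≤ y ^ 2 / 2 * B := by
  rw [mul_div_right_comm, abs_mul, abs_of_nonneg (one_sub_cos_mul_div_sq_nonneg y t)]
  exact mul_le_mul (one_sub_cos_mul_div_sq_le y ht) (hg t ht) (abs_nonneg _) (by positivity)

theorem abs_one_sub_cos_mul_mul_div_sq_le_rpow {g : ℝ → ℝ} {B : ℝ} (hg : ∀ t > 0, |g t| ≤ B)
    (y : ℝ) {t : ℝ} (ht : 0 < t) :
    |(1 - cos (y * t)) * g t / t ^ 2| ≤ 2 * B * t ^ (-2 : ℝ) := by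
  have hB : |g t| ≤ B := hg t ht
  rw [abs_div, abs_mul, abs_of_nonneg (show 0 ≤ 1 - cos (y * t) by
    linarith [Real.cos_le_one (y * t)]), abs_of_pos (show 0 < t ^ 2 by positivity),
    Real.rpow_neg ht.le, Real.rpow_two, ← div_eq_mul_inv]
  gcongr
  linarith [Real.neg_one_le_cos (y * t)]

theorem integrableOn_one_sub_cos_mul_mul_div_sq {g : ℝ → ℝ} {B : ℝ} (hg : ∀ t > 0, |g t| ≤ B)
    (hbv : BoundedVariationOn g (Ioi 0)) (y : ℝ) :
    IntegrableOn (fun t => (1 - cos (y * t)) * g t / t ^ 2) (Ioi 0) := by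
  have hmeas : AEMeasurable g (volume.restrict (Ioi 0)) := by
    obtain ⟨p, q, hp, hq, rfl⟩ :=
      hbv.locallyBoundedVariationOn.exists_monotoneOn_sub_monotoneOn
    exact (aemeasurable_restrict_of_monotoneOn measurableSet_Ioi hp).sub
      (aemeasurable_restrict_of_monotoneOn measurableSet_Ioi hq)
  have hF : AEStronglyMeasurable (fun t => (1 - cos (y * t)) * g t / t ^ 2)
      (volume.restrict (Ioi 0)) := by
    refine AEMeasurable.aestronglyMeasurable ?_
    have : Measurable fun t : ℝ => 1 - cos (y * t) := by fun_prop
    exact (this.aemeasurable.mul hmeas).div (by fun_prop)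
  rw [← Ioc_union_Ioi_eq_Ioi zero_le_one]
  refine IntegrableOn.union ?_ ?_
  · refine Integrable.mono' (integrableOn_const (C := y ^ 2 / 2 * B) (by simp))
      (hF.mono_set Ioc_subset_Ioi_self) ?_
    exact (ae_restrict_mem measurableSet_Ioc).mono fun t ht =>
      abs_one_sub_cos_mul_mul_div_sq_le hg y ht.1
  · refine Integrable.mono' ((integrableOn_Ioi_rpow_of_lt (a := -2) (by norm_num)
      one_pos).const_mul (2 * B)) (hF.mono_set (Ioi_subset_Ioi zero_le_one)) ?_
    exact (ae_restrict_mem measurableSet_Ioi).mono fun t ht =>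
      abs_one_sub_cos_mul_mul_div_sq_le_rpow hg y (zero_lt_one.trans ht)

theorem abs_setIntegral_Ioi_one_sub_cos_le {g : ℝ → ℝ} {B : ℝ} (hg : ∀ t > 0, |g t| ≤ B)
    (y : ℝ) {c : ℝ} (hc : 0 < c) :
    |∫ t in Ioi c, (1 - cos (y * t)) * g t / t ^ 2| ≤ 2 * B / c := by
  rw [← Real.norm_eq_abs]
  refine (norm_integral_le_of_norm_le ((integrableOn_Ioi_rpow_of_lt (a := -2) (by norm_num)
      hc).const_mul (2 * B)) ((ae_restrict_mem measurableSet_Ioi).mono fun t ht =>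
      abs_one_sub_cos_mul_mul_div_sq_le_rpow hg y (hc.trans ht))).trans_eq ?_
  rw [integral_const_mul, integral_Ioi_rpow_of_lt (by norm_num) hc]
  norm_num [Real.rpow_neg_one, div_eq_mul_inv]

theorem abs_one_sub_cos_mul_mul_div_sq_sub_le {g : ℝ → ℝ} {B : ℝ} (hg : ∀ t > 0, |g t| ≤ B)
    (hbv : BoundedVariationOn g (Ioi 0)) (y : ℝ) {s t : ℝ} (hs : 0 < s) (hst : s ≤ t) :
    |(1 - cos (y * t)) * g t / t ^ 2 - (1 - cos (y * s)) * g s / s ^ 2| ≤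
      (10 * B * y ^ 2 * arctan (|y| * t) + y ^ 2 / 2 * variationOnFromTo g (Ioi 0) 1 t) -
      (10 * B * y ^ 2 * arctan (|y| * s) + y ^ 2 / 2 * variationOnFromTo g (Ioi 0) 1 s) := by
  have ht : 0 < t := hs.trans_le hst
  have hgv := variationOnFromTo.abs_sub_le_sub_of_le hbv.locallyBoundedVariationOn
    (mem_Ioi.2 one_pos) (mem_Ioi.2 hs) (mem_Ioi.2 ht) hst
  have hk := abs_one_sub_cos_mul_div_sq_sub_le y hs hst
  have hks := one_sub_cos_mul_div_sq_le y hs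
  have hgt := hg t ht
  calc _ = |((1 - cos (y * t)) / t ^ 2 - (1 - cos (y * s)) / s ^ 2) * g t +
        (1 - cos (y * s)) / s ^ 2 * (g t - g s)| := by congr 1; ring
    _ ≤ |(1 - cos (y * t)) / t ^ 2 - (1 - cos (y * s)) / s ^ 2| * |g t| +
        (1 - cos (y * s)) / s ^ 2 * |g t - g s| := by
      refine (abs_add_le _ _).trans_eq ?_
      rw [abs_mul, abs_mul, abs_of_nonneg (one_sub_cos_mul_div_sq_nonneg y s)]
    _ ≤ 10 * y ^ 2 * (arctan (|y| * t) - arctan (|y| * s)) * B + y ^ 2 / 2 *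
        (variationOnFromTo g (Ioi 0) 1 t - variationOnFromTo g (Ioi 0) 1 s) :=
      add_le_add (mul_le_mul hk hgt (abs_nonneg _) ((abs_nonneg _).trans hk))
        (mul_le_mul hks hgv (abs_nonneg _) (by positivity))
    _ = _ := by ring

theorem abs_sum_sub_intervalIntegral_one_sub_cos_le {g : ℝ → ℝ} {B V : ℝ} (hB : 0 ≤ B)
    (hV : 0 ≤ V) (hg : ∀ t > 0, |g t| ≤ B)
    (hbv : eVariationOn g (Ioi 0) ≤ ENNReal.ofReal V) (y : ℝ) {ε : ℝ} (hε : 0 < ε)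
    {m n : ℕ} (hm : 1 ≤ m) (hmn : m ≤ n) :
    |∑ k ∈ Finset.Ioc m n, ε * ((1 - cos (y * (ε * k))) * g (ε * k) / (ε * k) ^ 2) -
      ∫ t in (ε * m)..(ε * n), (1 - cos (y * t)) * g t / t ^ 2| ≤
      ε * y ^ 2 * (10 * B * π + V / 2) := by
  have hbv' : BoundedVariationOn g (Ioi 0) := ne_top_of_le_ne_top ENNReal.ofReal_ne_top hbv
  refine (abs_sum_sub_intervalIntegral_le hε
    (fun s t hs hst => abs_one_sub_cos_mul_mul_div_sq_sub_le hg hbv' y hs hst)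
    (integrableOn_one_sub_cos_mul_mul_div_sq hg hbv' y) hm hmn).trans ?_
  have hm0 : (0 : ℝ) < m := by exact_mod_cast hm
  have hn0 : (0 : ℝ) < n := by exact_mod_cast hm.trans hmn
  have hvar : variationOnFromTo g (Ioi 0) 1 (ε * n) - variationOnFromTo g (Ioi 0) 1 (ε * m) ≤
      V := by
    rw [variationOnFromTo.sub_right hbv'.locallyBoundedVariationOn (mem_Ioi.2 one_pos)
      (mem_Ioi.2 (by positivity)) (mem_Ioi.2 (by positivity))]
    exact (le_abs_self _).trans ((variationOnFromTo.abs_le_eVariationOn hbv').trans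
      (ENNReal.toReal_le_of_le_ofReal hV hbv))
  have harc : arctan (|y| * (ε * n)) - arctan (|y| * (ε * m)) ≤ π := by
    linarith [arctan_lt_pi_div_two (|y| * (ε * n)), neg_pi_div_two_lt_arctan (|y| * (ε * m))]
  calc _ = ε * (10 * B * y ^ 2 * (arctan (|y| * (ε * n)) - arctan (|y| * (ε * m))) +
        y ^ 2 / 2 * (variationOnFromTo g (Ioi 0) 1 (ε * n) -
          variationOnFromTo g (Ioi 0) 1 (ε * m))) := by ring
    _ ≤ ε * (10 * B * y ^ 2 * π + y ^ 2 / 2 * V) := by gcongr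
    _ = _ := by ring

theorem abs_sum_sub_setIntegral_one_sub_cos_le {g : ℝ → ℝ} {B V : ℝ} (hB : 0 ≤ B)
    (hV : 0 ≤ V) (hg : ∀ t > 0, |g t| ≤ B)
    (hbv : eVariationOn g (Ioi 0) ≤ ENNReal.ofReal V) (y : ℝ) {ε : ℝ} (hε : 0 < ε)
    {m n : ℕ} (hm : 1 ≤ m) (hmn : m ≤ n) :
    |∑ k ∈ Finset.Ioc m n, ε * ((1 - cos (y * (ε * k))) * g (ε * k) / (ε * k) ^ 2) -
      ∫ t in Ioi (0 : ℝ), (1 - cos (y * t)) * g t / t ^ 2| ≤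
      ε * y ^ 2 * (10 * B * π + V / 2) + y ^ 2 / 2 * B * (ε * m) + 2 * B / (ε * n) := by
  have hF := integrableOn_one_sub_cos_mul_mul_div_sq hg
    (ne_top_of_le_ne_top ENNReal.ofReal_ne_top hbv) y
  have hm0 : (0 : ℝ) < m := by exact_mod_cast hm
  have hn0 : (0 : ℝ) < n := by exact_mod_cast hm.trans hmn
  have hF' : ∀ c : ℝ, 0 < c → IntegrableOn (fun t => (1 - cos (y * t)) * g t / t ^ 2) (Ioi c) :=
    fun c hc => hF.mono_set (Ioi_subset_Ioi hc.le)
  rw [← intervalIntegral.integral_interval_add_Ioi hF (hF' (ε * m) (by positivity)),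
    ← intervalIntegral.integral_interval_add_Ioi (hF' (ε * m) (by positivity))
      (hF' (ε * n) (by positivity))]
  have hmid := abs_sum_sub_intervalIntegral_one_sub_cos_le hB hV hg hbv y hε hm hmn
  have htail := abs_setIntegral_Ioi_one_sub_cos_le hg y (c := ε * n) (by positivity)
  have hhead : |∫ t in (0 : ℝ)..(ε * m), (1 - cos (y * t)) * g t / t ^ 2| ≤
      y ^ 2 / 2 * B * (ε * m) := by
    have h0 : 0 < ε * m := by positivity
    have := intervalIntegral.norm_integral_le_of_norm_le_const (a := 0) (b := ε * m)
      (f := fun t => (1 - cos (y * t)) * g t / t ^ 2) (C := y ^ 2 / 2 * B) fun t ht =>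
        abs_one_sub_cos_mul_mul_div_sq_le hg y (by rw [uIoc_of_le h0.le] at ht; exact ht.1)
    rwa [sub_zero, abs_of_pos h0, Real.norm_eq_abs] at this
  rw [abs_le] at *
  constructor <;> linarith [hmid.1, hmid.2, htail.1, htail.2, hhead.1, hhead.2]

theorem abs_summand_sub_le {ν q B : ℝ} (hν : 0 < ν) (hq : 0 < q) {f : ℝ → ℝ≥0∞} {h : ℝ → ℝ}
    (hf : ∀ t > (0 : ℝ), ENNReal.ofReal q ≤ f t) (hg : ∀ t > (0 : ℝ), |gfun f h t| ≤ B)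
    {ε : ℝ} (hε : 0 < ε) (y : ℝ) {k : ℕ} (hk : 0 < k) :
    |(if f (ε * k) = ⊤ then 0 else
        (1 - cos (ε * k * y)) * h (ε * k) ^ 2 /
          (2 * π * ε * (1 + ν * (k : ℝ) ^ 2 * (f (ε * k)).toReal))) -
      1 / (2 * π * ν) *
        (ε * ((1 - cos (y * (ε * k))) * gfun f h (ε * k) / (ε * k) ^ 2))| ≤
      ε * y ^ 2 * (B / (4 * π * ν ^ 2 * q)) * (1 / (k : ℝ) ^ 2) := by
  have hk0 : (0 : ℝ) < k := by exact_mod_cast hk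
  have hεk : 0 < ε * k := by positivity
  have hB := hg _ hεk
  have hB0 : 0 ≤ B := (abs_nonneg _).trans hB
  by_cases htop : f (ε * k) = ⊤
  · simp only [gfun, htop, if_true, mul_zero, zero_div, sub_zero, abs_zero]
    positivity
  have hF : q ≤ (f (ε * k)).toReal := (ENNReal.ofReal_le_iff_le_toReal htop).1 (hf _ hεk)
  rw [if_neg htop]
  simp only [gfun, if_neg htop] at hB ⊢
  generalize (f (ε * k)).toReal = F at *
  have hF0 : 0 < F := hq.trans_le hF
  rw [abs_of_nonneg (by positivity)] at hB
  have hc := one_sub_cos_le (y * (ε * k))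
  have hc0 : 0 ≤ 1 - cos (y * (ε * k)) := by linarith [Real.cos_le_one (y * (ε * k))]
  rw [mul_comm (ε * k) y]
  generalize 1 - cos (y * (ε * k)) = c at *
  calc _ = |-(c * (h (ε * k) ^ 2 / F) /
        (2 * π * ε * (ν * k ^ 2) * (1 + ν * (k : ℝ) ^ 2 * F)))| := by
        congr 1; field_simp; ring
    _ = c * (h (ε * k) ^ 2 / F) /
        (2 * π * ε * (ν * k ^ 2) * (1 + ν * (k : ℝ) ^ 2 * F)) := by
        rw [abs_neg, abs_of_nonneg (by positivity)]
    _ ≤ (y * (ε * k)) ^ 2 / 2 * B / (2 * π * ε * (ν * k ^ 2) * (ν * (k : ℝ) ^ 2 * q)) := by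
        gcongr
        linarith [show ν * (k : ℝ) ^ 2 * q ≤ ν * (k : ℝ) ^ 2 * F by gcongr]
    _ = _ := by field_simp; ring

theorem abs_sum_summand_sub_le {ν q B : ℝ} (hν : 0 < ν) (hq : 0 < q) {f : ℝ → ℝ≥0∞}
    {h : ℝ → ℝ} (hf : ∀ t > (0 : ℝ), ENNReal.ofReal q ≤ f t)
    (hg : ∀ t > (0 : ℝ), |gfun f h t| ≤ B) (hB : 0 ≤ B) {ε : ℝ} (hε : 0 < ε) (y : ℝ) (m n : ℕ) :
    |∑ k ∈ Finset.Ioc m n, (if f (ε * k) = ⊤ then 0 else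
        (1 - cos (ε * k * y)) * h (ε * k) ^ 2 /
          (2 * π * ε * (1 + ν * (k : ℝ) ^ 2 * (f (ε * k)).toReal))) -
      1 / (2 * π * ν) * ∑ k ∈ Finset.Ioc m n,
        ε * ((1 - cos (y * (ε * k))) * gfun f h (ε * k) / (ε * k) ^ 2)| ≤
      ε * y ^ 2 * (B / (4 * π * ν ^ 2 * q)) * ∑' k : ℕ, 1 / (k : ℝ) ^ 2 := by
  have hsum : Summable fun k : ℕ => 1 / (k : ℝ) ^ 2 :=
    Real.summable_one_div_nat_pow.2 one_lt_two
  rw [Finset.mul_sum, ← Finset.sum_sub_distrib]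
  calc _ ≤ ∑ k ∈ Finset.Ioc m n, ε * y ^ 2 * (B / (4 * π * ν ^ 2 * q)) * (1 / (k : ℝ) ^ 2) :=
        (Finset.abs_sum_le_sum_abs _ _).trans <| Finset.sum_le_sum fun k hk =>
          abs_summand_sub_le hν hq hf hg hε y (by rw [Finset.mem_Ioc] at hk; omega)
    _ ≤ _ := by
        rw [← Finset.mul_sum]
        gcongr
        exact hsum.sum_le_tsum _ fun k _ => by positivity

/-- The naturals strictly between `a` and `b` form an integer interval `(m, n]` with `m ≤ a` and
`b ≤ 2 n`. -/
theorem exists_nat_Ioc_eq_of_one_le {a b : ℝ} (ha : 1 ≤ a) :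
    ∃ m n : ℕ, 1 ≤ m ∧ m ≤ n ∧ (m : ℝ) ≤ a ∧ b ≤ 2 * n ∧
      ∀ k : ℕ, (a < k ∧ (k : ℝ) < b) ↔ k ∈ Finset.Ioc m n := by
  have ha0 : 0 ≤ a := zero_le_one.trans ha
  have hm : 1 ≤ ⌊a⌋₊ := Nat.one_le_floor_iff a |>.2 ha
  refine ⟨⌊a⌋₊, max ⌊a⌋₊ (⌈b⌉₊ - 1), hm, le_max_left _ _, Nat.floor_le ha0, ?_, fun k => ?_⟩
  · have h1 : (⌈b⌉₊ : ℝ) ≤ 2 * (max ⌊a⌋₊ (⌈b⌉₊ - 1) : ℕ) := by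
      exact_mod_cast (by omega : ⌈b⌉₊ ≤ 2 * max ⌊a⌋₊ (⌈b⌉₊ - 1))
    exact (Nat.le_ceil b).trans h1
  · rw [← Nat.floor_lt ha0, ← Nat.lt_ceil, Finset.mem_Ioc]
    omega

/-- Convergence of the discretized correction constant:
`|Λ_ε^y - Λ^y| ≤ C (ε^{1-γ} y² + ε y² + ε^{χ-1})`, with `C` depending only on
`ν, q, γ, χ`, the sup norms of `h` and `g = h²/f`, and the total variation of `g`. -/
theorem stmt_15 (ν q γ χ Bh Bg V : ℝ) (hν : 0 < ν) (hq0 : 0 < q) (hq1 : q ≤ 1)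
    (hγ : 0 < γ) (hγχ : γ < χ) (hBh : 0 ≤ Bh) (hBg : 0 ≤ Bg) (hV : 0 ≤ V) :
    ∃ C > 0, ∀ (f : ℝ → ℝ≥0∞) (h : ℝ → ℝ),
      (∀ t > (0 : ℝ), ENNReal.ofReal q ≤ f t) →
      (∀ t > (0 : ℝ), |h t| ≤ Bh) →
      (∀ t > (0 : ℝ), |gfun f h t| ≤ Bg) →
      eVariationOn (gfun f h) (Set.Ioi 0) ≤ ENNReal.ofReal V →
      ∀ ε ∈ Set.Ioc (0 : ℝ) 1, ∀ y : ℝ,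
      |(∑' k : ℕ, if ε ^ (-γ) < (k : ℝ) ∧ (k : ℝ) < ε ^ (-χ) then
            (if f (ε * k) = ⊤ then 0 else
              (1 - Real.cos (ε * k * y)) * h (ε * k) ^ 2 /
                (2 * π * ε * (1 + ν * (k : ℝ) ^ 2 * (f (ε * k)).toReal)))
          else 0) -
        (1 / (2 * π * ν)) *
          ∫ t in Set.Ioi (0 : ℝ), (1 - Real.cos (y * t)) * gfun f h t / t ^ 2| ≤
        C * (ε ^ (1 - γ) * y ^ 2 + ε * y ^ 2 + ε ^ (χ - 1)) := by
  refine ⟨Bg / (4 * π * ν ^ 2 * q) * ∑' k : ℕ, 1 / (k : ℝ) ^ 2 +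
    1 / (2 * π * ν) * (10 * Bg * π + V / 2 + Bg / 2 + 4 * Bg) + 1, by positivity, ?_⟩
  intro f h hf _ hg hbv ε ⟨hε, hε1⟩ y
  obtain ⟨m, n, hm, hmn, hma, hnb, hk⟩ := exists_nat_Ioc_eq_of_one_le (b := ε ^ (-χ))
    (Real.one_le_rpow_of_pos_of_le_one_of_nonpos hε hε1 (neg_nonpos.2 hγ.le))
  simp only [hk]
  rw [tsum_eq_sum (s := Finset.Ioc m n) fun k hk => if_neg hk,
    Finset.sum_congr rfl fun k hk => if_pos hk]
  have h1 := abs_sum_summand_sub_le hν hq0 hf hg hBg hε y m n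
  have h2 := abs_sum_sub_setIntegral_one_sub_cos_le hBg hV hg hbv y hε hm hmn
  have hhead : ε * m ≤ ε ^ (1 - γ) := by
    rw [sub_eq_add_neg, Real.rpow_add hε, Real.rpow_one]
    gcongr
  have htail : 2 * Bg / (ε * n) ≤ 4 * Bg * ε ^ (χ - 1) := by
    have hn0 : (0 : ℝ) < n := by exact_mod_cast hm.trans hmn
    have hχ : 1 ≤ ε ^ (χ - 1) * (ε * (2 * n)) := by
      calc 1 = ε ^ (χ - 1) * (ε * ε ^ (-χ)) := by
            rw [← mul_assoc, ← Real.rpow_add_one hε.ne', ← Real.rpow_add hε,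
              show χ - 1 + 1 + -χ = 0 by ring, Real.rpow_zero]
        _ ≤ _ := by gcongr
    rw [div_le_iff₀ (by positivity)]
    linarith [mul_le_mul_of_nonneg_left hχ (show 0 ≤ 2 * Bg by positivity)]
  have hS : 0 ≤ ∑' k : ℕ, 1 / (k : ℝ) ^ 2 := tsum_nonneg fun k => by positivity
  set S := ∑' k : ℕ, 1 / (k : ℝ) ^ 2
  set D := ∑ k ∈ Finset.Ioc m n,
    ε * ((1 - cos (y * (ε * k))) * gfun f h (ε * k) / (ε * k) ^ 2)
  set T := ∑ k ∈ Finset.Ioc m n, (if f (ε * k) = ⊤ then 0 else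
        (1 - cos (ε * k * y)) * h (ε * k) ^ 2 /
          (2 * π * ε * (1 + ν * (k : ℝ) ^ 2 * (f (ε * k)).toReal)))
  set I := ∫ t in Ioi (0 : ℝ), (1 - cos (y * t)) * gfun f h t / t ^ 2
  have hX : 0 ≤ ε ^ (1 - γ) * y ^ 2 := by positivity
  have hY : 0 ≤ ε * y ^ 2 := by positivity
  have hZ : 0 ≤ ε ^ (χ - 1) := by positivity
  have h2' : |D - I| ≤ (10 * Bg * π + V / 2 + Bg / 2 + 4 * Bg) *
      (ε ^ (1 - γ) * y ^ 2 + ε * y ^ 2 + ε ^ (χ - 1)) := by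
    calc _ ≤ (10 * Bg * π + V / 2) * (ε * y ^ 2) + Bg / 2 * (ε ^ (1 - γ) * y ^ 2) +
          4 * Bg * ε ^ (χ - 1) := by
          linarith [mul_le_mul_of_nonneg_left hhead (show 0 ≤ y ^ 2 / 2 * Bg by positivity)]
      _ ≤ (10 * Bg * π + V / 2) * (ε ^ (1 - γ) * y ^ 2 + ε * y ^ 2 + ε ^ (χ - 1)) +
          Bg / 2 * (ε ^ (1 - γ) * y ^ 2 + ε * y ^ 2 + ε ^ (χ - 1)) +
          4 * Bg * (ε ^ (1 - γ) * y ^ 2 + ε * y ^ 2 + ε ^ (χ - 1)) := by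
          gcongr <;> linarith
      _ = _ := by ring
  calc |T - 1 / (2 * π * ν) * I|
      = |(T - 1 / (2 * π * ν) * D) + 1 / (2 * π * ν) * (D - I)| := by congr 1; ring
    _ ≤ |T - 1 / (2 * π * ν) * D| + 1 / (2 * π * ν) * |D - I| := by
        refine (abs_add_le _ _).trans_eq ?_
        rw [abs_mul, abs_of_nonneg (show 0 ≤ 1 / (2 * π * ν) by positivity)]
    _ ≤ Bg / (4 * π * ν ^ 2 * q) * S * (ε * y ^ 2) + 1 / (2 * π * ν) *
        ((10 * Bg * π + V / 2 + Bg / 2 + 4 * Bg) *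
          (ε ^ (1 - γ) * y ^ 2 + ε * y ^ 2 + ε ^ (χ - 1))) := by
        gcongr
        linarith
    _ ≤ Bg / (4 * π * ν ^ 2 * q) * S * (ε ^ (1 - γ) * y ^ 2 + ε * y ^ 2 + ε ^ (χ - 1)) +
        1 / (2 * π * ν) * ((10 * Bg * π + V / 2 + Bg / 2 + 4 * Bg) *
          (ε ^ (1 - γ) * y ^ 2 + ε * y ^ 2 + ε ^ (χ - 1))) +
        1 * (ε ^ (1 - γ) * y ^ 2 + ε * y ^ 2 + ε ^ (χ - 1)) := by
        refine le_add_of_le_of_nonneg ?_ (by linarith)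
        gcongr
        linarith
    _ = _ := by ring
end
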